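/- For every positive integer n, the sum s_n of all entries of the character table of S_n satisfies s_n = Σ_{k=0}^{n} i_k · g_{n−k}, where i_k is the number of involutions in S_k and g_m is the sum over partitions ν of m with no part equal to 1 of the number of square roots in S_m of a permutation of cycle type ν (with g₀ = 1). -/

import Mathlib

open CategoryTheory
open scoped ComplexOrder

/-- `S` is the (finite) set of irreducible complex characters of `G`. -/
def IsIrrFamily (G : Type) [Group G] (S : Finset (G → ℂ)) : Prop :=
  (∀ f ∈ S, ∃ V : FDRep ℂ G, Simple V ∧ V.character = f) ∧
  ∀ V : FDRep ℂ G, Simple V → V.character ∈ S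

/-- The character table sum. -/
noncomputable def tableSum (G : Type) [Group G] (S : Finset (G → ℂ)) : ℂ :=
  ∑ f ∈ S, ∑ᶠ C : ConjClasses G, f (Quotient.out C)

/-- The number of involutions in `S_k`. -/
noncomputable def numInvolutions (k : ℕ) : ℕ :=
  Nat.card {x : Equiv.Perm (Fin k) // x ^ 2 = 1}

/-- The number of square roots in `S_m` of a (fixed) permutation of cycle type `ν`. -/
noncomputable def sqrtCount {m : ℕ} (ν : m.Partition) : ℕ :=
  if h : ∃ w : Equiv.Perm (Fin m), w.partition.parts = ν.parts then
    Nat.card {x : Equiv.Perm (Fin m) // x ^ 2 = h.choose}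
  else 0

/-- `g_m`: the sum, over partitions `ν` of `m` with no part equal to `1`
(conjugacy classes of derangements), of the number of square roots of a
permutation of cycle type `ν`.  (`g₀ = 1`.) -/
noncomputable def gFun (m : ℕ) : ℕ :=
  ∑ ν ∈ Finset.univ.filter (fun ν : m.Partition => 1 ∉ ν.parts), sqrtCount ν

lemma card_sqrt_congr {G H : Type*} [Group G] [Group H] (e : G ≃* H) {g : G} {h : H}
    (hgh : IsConj (e g) h) :
    Nat.card {x : G // x ^ 2 = g} = Nat.card {x : H // x ^ 2 = h} := by
  obtain ⟨c, rfl⟩ := isConj_iff.1 hgh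
  refine Nat.card_congr ((e.trans (MulAut.conj c)).toEquiv.subtypeEquiv fun x => ?_)
  change _ ↔ (e.trans (MulAut.conj c)) x ^ 2 = (e.trans (MulAut.conj c)) g
  rw [← map_pow, EquivLike.apply_eq_iff_eq]

lemma Equiv.Perm.cycleType_permCongr {α β : Type*} [Fintype α] [Fintype β] [DecidableEq α]
    [DecidableEq β] (e : α ≃ β) (g : Equiv.Perm α) : (e.permCongr g).cycleType = g.cycleType := by
  rw [← Equiv.Perm.cycleType_extendDomain (p := fun _ : β => True)
    (e.trans (Equiv.Set.univ β).symm)]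
  congr 1

lemma Equiv.Perm.card_sqrt_eq_of_cycleType_eq {α β : Type*} [Fintype α] [Fintype β]
    [DecidableEq α] [DecidableEq β] {g : Equiv.Perm α} {h : Equiv.Perm β}
    (hc : Fintype.card α = Fintype.card β) (hgh : g.cycleType = h.cycleType) :
    Nat.card {x : Equiv.Perm α // x ^ 2 = g} = Nat.card {x : Equiv.Perm β // x ^ 2 = h} := by
  let e := Fintype.equivOfCardEq hc
  refine card_sqrt_congr e.permCongrHom (Equiv.Perm.isConj_of_cycleType_eq ?_)
  exact (Equiv.Perm.cycleType_permCongr e g).trans hgh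

lemma Equiv.Perm.card_sqrt_eq_mul {α : Type*} (w : Equiv.Perm α) :
    Nat.card {x : Equiv.Perm α // x ^ 2 = w} =
      Nat.card {y : Equiv.Perm {a // ¬ w a ≠ a} // y ^ 2 = 1} *
        Nat.card {z : Equiv.Perm {a // w a ≠ a} //
          z ^ 2 = w.subtypePerm fun a => (w.injective.ne_iff (x := w a) (y := a))} := by
  classical
  have hx {x : Equiv.Perm α} (hx : x ^ 2 = w) (a : α) : w (x a) ≠ x a ↔ w a ≠ a := by
    rw [← x.injective.ne_iff (x := w a), ← hx]
    rfl
  rw [mul_comm, ← Nat.card_prod]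
  refine Nat.card_congr
    { toFun := fun x => (⟨x.1.subtypePerm (hx x.2), ?_⟩,
        ⟨x.1.subtypePerm fun a => not_congr (hx x.2 a), ?_⟩)
      invFun := fun y => ⟨Equiv.Perm.subtypeCongr y.1.1 y.2.1, ?_⟩
      left_inv := fun x => ?_
      right_inv := fun y => ?_ }
  · ext a
    simp [← x.2]
  · ext a
    have := not_not.1 a.2
    simpa [← x.2] using this
  · obtain ⟨⟨z, hz⟩, y, hy⟩ := y
    ext a
    by_cases ha : w a ≠ a
    · have := congrArg Subtype.val (Equiv.congr_fun hz ⟨a, ha⟩)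
      simpa [pow_two, Equiv.Perm.subtypeCongr.apply, ha, (z ⟨a, ha⟩).2] using this
    · have := congrArg Subtype.val (Equiv.congr_fun hy ⟨a, ha⟩)
      have h2 := (y ⟨a, ha⟩).2
      have h3 := not_not.1 ha
      simp only [pow_two, Equiv.Perm.mul_apply, Equiv.Perm.one_apply] at this
      simpa [pow_two, Equiv.Perm.subtypeCongr.apply, ha, h2, h3] using this
  · ext a
    by_cases ha : w a ≠ a <;> simp [ha]
  · ext a
    · simp [a.2]
    · simp [not_not.1 a.2]

/-- The representation `ρ` carries a nonzero invariant symmetric bilinear form. -/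
def HasInvariantSymmForm {G V : Type} [Group G] [AddCommGroup V] [Module ℂ V]
    (ρ : Representation ℂ G V) : Prop :=
  ∃ β : V →ₗ[ℂ] V →ₗ[ℂ] ℂ, β ≠ 0 ∧ (∀ v w, β v w = β w v) ∧
    ∀ g v w, β (ρ g v) (ρ g w) = β v w

section Irreducible

variable {G V : Type} [Group G] [AddCommGroup V] [Module ℂ V] [FiniteDimensional ℂ V]
  (ρ : Representation ℂ G V) [ρ.IsIrreducible]

lemma exists_eq_sum_smul_of_isIrreducible [Fintype G] (T : V →ₗ[ℂ] V) :
    ∃ a : G → ℂ, T = ∑ g, a g • ρ g := by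
  have : DecidableEq ρ.asModule := Classical.decEq _
  have hs : Function.Bijective (algebraMap ℂ (Module.End (MonoidAlgebra ℂ G) ρ.asModule)) :=
    IsSimpleModule.algebraMap_end_bijective_of_isAlgClosed ℂ
  let f : Module.End (Module.End (MonoidAlgebra ℂ G) ρ.asModule) ρ.asModule :=
    { toFun := fun v => T v
      map_add' := fun v w => T.map_add v w
      map_smul' := fun φ v => by
        obtain ⟨c, rfl⟩ := hs.2 φ
        exact T.map_smul c v }
  let b := Module.finBasis ℂ V
  obtain ⟨a, ha⟩ := jacobson_density f (Finset.univ.image (β := ρ.asModule) b)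
  refine ⟨a.coeff, b.ext fun i => ?_⟩
  have hb : T (b i) = ρ.asAlgebraHom a (b i) :=
    ha (b i) (Finset.mem_image_of_mem _ (Finset.mem_univ i))
  rw [hb, Representation.asAlgebraHom_def, MonoidAlgebra.lift_apply, Finsupp.sum_fintype]
  simp

lemma exists_invariant_equiv_dual [Fintype G] (hinv : ∀ g : G, IsConj g g⁻¹) :
    ∃ f : V ≃ₗ[ℂ] Module.Dual ℂ V, ∀ g v w, f (ρ g v) (ρ g w) = f v w := by
  classical
  have : Invertible (Nat.card G : ℂ) := invertibleOfNonzero (NeZero.ne _)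
  have hreal (g : G) : ρ.character g⁻¹ = ρ.character g := by
    obtain ⟨c, hc⟩ := isConj_iff.1 (hinv g)
    rw [← hc, ρ.char_conj]
  have h1 := Representation.card_inv_mul_sum_char_mul_char_eq_finrank ρ ρ.dual
  have h2 := Representation.card_inv_mul_sum_char_mul_char_eq_finrank ρ ρ
  simp only [Representation.char_dual, hreal] at h1 h2
  rw [h2, Representation.IsIrreducible.finrank_intertwiningMap_self] at h1
  have h3 : 0 < Module.finrank ℂ (Representation.IntertwiningMap ρ ρ.dual) := by
    have : (1 : ℕ) = Module.finrank ℂ (Representation.IntertwiningMap ρ ρ.dual) := by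
      exact_mod_cast h1
    omega
  have := Module.nontrivial_of_finrank_pos h3
  obtain ⟨f, hf⟩ := exists_ne (0 : Representation.IntertwiningMap ρ ρ.dual)
  have hinj := (Representation.IsIrreducible.injective_or_eq_zero f).resolve_right hf
  refine ⟨LinearEquiv.ofInjectiveOfFinrankEq f.toLinearMap hinj Subspace.dual_finrank_eq.symm,
    fun g v w => ?_⟩
  have h4 : f (ρ g v) (ρ g w) = (ρ.dual g (f v)) (ρ g w) := by rw [f.isIntertwining]
  rw [Representation.dual_apply, Module.Dual.transpose_apply, LinearMap.comp_apply,
    ← Module.End.mul_apply, ← map_mul, inv_mul_cancel, map_one, Module.End.one_apply] at h4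
  exact h4

lemma hasInvariantSymmForm_of_equiv [Fintype G] {H : Type} [Group H] [Finite H] (φ : H →* G)
    (hφ : ∀ g : G, ∃ h : H, φ h * g * (φ h)⁻¹ = g⁻¹)
    (hH : HasInvariantSymmForm (ρ.comp φ)) : HasInvariantSymmForm ρ := by
  classical
  have := Fintype.ofFinite H
  obtain ⟨f, hf⟩ := exists_invariant_equiv_dual ρ
    fun g => isConj_iff.2 ((hφ g).imp' φ fun _ h => h)
  obtain ⟨β, hβ0, hβs, hβ⟩ := hH
  let T : V →ₗ[ℂ] V := f.symm.toLinearMap ∘ₗ β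
  have hT (v w : V) : f (T v) w = β v w := by simp [T]
  have hf' (g : G) (v w : V) : f (ρ g v) w = f v (ρ g⁻¹ w) := by
    rw [← hf g v, ← Module.End.mul_apply, ← map_mul]; simp
  have hTH (h : H) : ρ (φ h) * T * ρ (φ h)⁻¹ = T := by
    ext v
    apply f.injective
    ext w
    have := hβ h (ρ (φ h)⁻¹ v) (ρ (φ h)⁻¹ w)
    simp only [MonoidHom.coe_comp, Function.comp_apply, ← Module.End.mul_apply, ← map_mul] at this
    simp only [Module.End.mul_apply, hf', hT]
    rw [← this]; simp
  obtain ⟨a, hTa⟩ := exists_eq_sum_smul_of_isIrreducible ρ T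
  have hTsum : (Fintype.card H : ℂ) • T = ∑ g, a g • ∑ h, ρ (φ h * g * (φ h)⁻¹) := by
    simp only [Finset.smul_sum]
    rw [Finset.sum_comm]
    have (h : H) : ∑ g, a g • ρ (φ h * g * (φ h)⁻¹) = T := by
      conv_rhs => rw [← hTH h, hTa]
      simp [Finset.mul_sum, Finset.sum_mul]
    simp only [this]
    simp [← Nat.cast_smul_eq_nsmul ℂ]
  have hswap (g : G) : ∑ h, ρ (φ h * g⁻¹ * (φ h)⁻¹) = ∑ h, ρ (φ h * g * (φ h)⁻¹) := by
    obtain ⟨k, hk⟩ := hφ g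
    rw [← hk]
    refine Fintype.sum_equiv (Equiv.mulRight k) _ _ fun h => ?_
    simp [mul_assoc]
  have hadj (v w : V) : f (T v) w = f v (T w) := by
    have hc : (Fintype.card H : ℂ) ≠ 0 := by simp
    apply mul_left_cancel₀ hc
    have e1 : (Fintype.card H : ℂ) * f (T v) w = f (((Fintype.card H : ℂ) • T) v) w := by simp
    have e2 : (Fintype.card H : ℂ) * f v (T w) = f v (((Fintype.card H : ℂ) • T) w) := by simp
    rw [e1, e2, hTsum]
    conv_rhs => enter [2, 1, 2, g]; rw [← hswap g]
    simp [LinearMap.sum_apply, hf', mul_assoc]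
  let γ : V →ₗ[ℂ] V →ₗ[ℂ] ℂ := f.toLinearMap + LinearMap.flip f.toLinearMap
  have hγ (v w : V) : γ v w = f v w + f w v := rfl
  refine ⟨γ, fun h0 => hβ0 ?_, fun v w => ?_, fun g v w => ?_⟩
  · ext v w
    have h1 := hγ (T w) v
    rw [h0, ← hadj v w, hT, hT, hβs w v] at h1
    simp only [LinearMap.zero_apply] at h1 ⊢
    linear_combination - h1 / 2
  · rw [hγ, hγ, add_comm]
  · rw [hγ, hγ, hf, hf]

end Irreducible

lemma HasInvariantSymmForm.of_intertwining {G V W : Type} [Group G] [AddCommGroup V] [Module ℂ V]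
    [AddCommGroup W] [Module ℂ W] {ρ : Representation ℂ G V} {σ : Representation ℂ G W}
    (p : Representation.IntertwiningMap ρ σ) (hp : Function.Surjective p)
    (h : HasInvariantSymmForm σ) : HasInvariantSymmForm ρ := by
  obtain ⟨β, hβ0, hβs, hβ⟩ := h
  refine ⟨β.compl₁₂ p.toLinearMap p.toLinearMap, fun h0 => hβ0 ?_, fun v w => ?_,
    fun g v w => ?_⟩
  · ext x y
    obtain ⟨v, rfl⟩ := hp x
    obtain ⟨w, rfl⟩ := hp y
    exact LinearMap.congr_fun₂ h0 v w
  · exact hβs _ _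
  · simpa [p.isIntertwining] using hβ g (p v) (p w)

lemma exists_invariant_submodule_of_not_isIrreducible {G V : Type} [Group G] [AddCommGroup V]
    [Module ℂ V] [Nontrivial V] (ρ : Representation ℂ G V) (h : ¬ ρ.IsIrreducible) :
    ∃ W : Submodule ℂ V, W ≠ ⊥ ∧ W ≠ ⊤ ∧ ∀ g, W ≤ W.comap (ρ g) := by
  by_contra! hW
  apply h
  have : Nontrivial (Subrepresentation ρ) := ⟨⊥, ⊤, fun h =>
    bot_ne_top (α := Submodule ℂ V) (congrArg Subrepresentation.toSubmodule h)⟩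
  refine ⟨fun a => or_iff_not_imp_left.2 fun ha => ?_⟩
  by_contra ha'
  obtain ⟨g, hg⟩ := hW a.toSubmodule
    (fun h => ha (Subrepresentation.toSubmodule_injective h))
    (fun h => ha' (Subrepresentation.toSubmodule_injective h))
  exact hg fun v hv => a.apply_mem_toSubmodule g hv

lemma HasInvariantSymmForm.of_forall_isIrreducible {G : Type} [Group G]
    (hG : ∀ (V : Type) [AddCommGroup V] [Module ℂ V] [FiniteDimensional ℂ V]
      (ρ : Representation ℂ G V) [ρ.IsIrreducible], HasInvariantSymmForm ρ)
    (V : Type) [AddCommGroup V] [Module ℂ V] [FiniteDimensional ℂ V] [Nontrivial V]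
    (ρ : Representation ℂ G V) : HasInvariantSymmForm ρ := by
  induction hd : Module.finrank ℂ V using Nat.strong_induction_on generalizing V with
  | _ d ih =>
    by_cases h : ρ.IsIrreducible
    · exact hG V ρ
    obtain ⟨W, hW, hW', hρ⟩ := exists_invariant_submodule_of_not_isIrreducible ρ h
    have := Submodule.Quotient.nontrivial_iff.2 hW'
    refine .of_intertwining (σ := ρ.quotient W hρ) ⟨W.mkQ, fun g => rfl⟩ W.mkQ_surjective
      (ih _ ?_ _ _ rfl)
    have h1 := W.finrank_quotient_add_finrank
    have h2 := (Submodule.one_le_finrank_iff (S := W)).2 hW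
    omega

lemma Equiv.Perm.exists_conj_eq_inv_of_fixes {α : Type*} (g : Equiv.Perm α) (a : α) :
    ∃ k : Equiv.Perm α, k a = a ∧ k * g * k⁻¹ = g⁻¹ := by
  classical
  let p : α → α := fun x =>
    if g.SameCycle a x then a else (Quotient.mk (Equiv.Perm.SameCycle.setoid g) x).out
  have hp (x : α) : g.SameCycle (p x) x := by
    by_cases h : g.SameCycle a x
    · simpa only [p, if_pos h] using h
    · simp only [p, if_neg h]
      exact Quotient.mk_out (s := Equiv.Perm.SameCycle.setoid g) x
  have hpeq {x y : α} (h : g.SameCycle x y) : p x = p y := by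
    have h1 : g.SameCycle a x ↔ g.SameCycle a y := ⟨fun h' => h'.trans h, fun h' => h'.trans h.symm⟩
    have h2 : Quotient.mk (Equiv.Perm.SameCycle.setoid g) x = Quotient.mk _ y := Quotient.sound h
    simp only [p, h1, h2]
  have hpa : p a = a := by simp [p, Equiv.Perm.SameCycle.refl]
  choose i hi using hp
  have hneg {m l : ℤ} {x : α} (h : (g ^ m) x = (g ^ l) x) : (g ^ (-m)) x = (g ^ (-l)) x := by
    apply (g ^ (m + l)).injective
    rw [← Equiv.Perm.mul_apply, ← Equiv.Perm.mul_apply, ← zpow_add, ← zpow_add,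
      add_neg_cancel_comm, add_neg_cancel_right, h]
  let k : α → α := fun x => (g ^ (-i x)) (p x)
  have hk {m : ℤ} {x : α} (h : (g ^ m) (p x) = x) : k x = (g ^ (-m)) (p x) :=
    hneg ((hi x).trans h.symm)
  have hpk (x : α) : p (k x) = p x := by
    refine (hpeq ⟨i x, ?_⟩).trans (hpeq ⟨i x, hi x⟩)
    rw [← Equiv.Perm.mul_apply, ← zpow_add, add_neg_cancel, zpow_zero, Equiv.Perm.one_apply]
  have hkk (x : α) : k (k x) = x := by
    rw [hk (x := k x) (m := -i x) (by rw [hpk]), hpk, neg_neg, hi]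
  refine ⟨⟨k, k, hkk, hkk⟩, ?_, mul_inv_eq_of_eq_mul (Equiv.ext fun x => ?_)⟩
  · change k a = a
    rw [hk (m := 0) (by simpa using hpa)]
    simpa using hpa
  · change k (g x) = g⁻¹ (k x)
    have hpg : p (g x) = p x := (hpeq ⟨1, by simp⟩).symm
    rw [hk (x := g x) (m := 1 + i x) (by rw [hpg, zpow_add, Equiv.Perm.mul_apply, hi, zpow_one]),
      hpg, neg_add, zpow_add, Equiv.Perm.mul_apply, zpow_neg_one]

lemma Equiv.Perm.hasInvariantSymmForm (n : ℕ) (V : Type) [AddCommGroup V] [Module ℂ V]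
    [FiniteDimensional ℂ V] [Nontrivial V] (ρ : Representation ℂ (Equiv.Perm (Fin n)) V) :
    HasInvariantSymmForm ρ := by
  induction n generalizing V with
  | zero =>
    obtain ⟨x, hx⟩ := exists_ne (0 : V)
    obtain ⟨l, hl⟩ : ∃ l : Module.Dual ℂ V, l x ≠ 0 := by
      by_contra! h
      exact hx ((Module.forall_dual_apply_eq_zero_iff ℂ x).1 h)
    refine ⟨LinearMap.smulRight l l, fun h => ?_, fun v w => ?_, fun g v w => ?_⟩
    · simpa [hl] using LinearMap.congr_fun₂ h x x
    · simp [mul_comm]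
    · rw [Subsingleton.elim g 1]; simp
  | succ n ih =>
    refine .of_forall_isIrreducible (fun V _ _ _ ρ _ => ?_) V ρ
    have hV : Nontrivial V := by
      by_contra h
      rw [not_nontrivial_iff_subsingleton] at h
      exact bot_ne_top (α := Subrepresentation ρ)
        (Subrepresentation.toSubmodule_injective (Subsingleton.elim _ _))
    let f := finSuccAboveEquiv (0 : Fin (n + 1))
    refine hasInvariantSymmForm_of_equiv ρ (Equiv.Perm.extendDomainHom f) (fun g => ?_) (ih V _)
    obtain ⟨k, hk0, hk⟩ := g.exists_conj_eq_inv_of_fixes 0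
    have hk' (x : Fin (n + 1)) : x ≠ 0 ↔ k x ≠ 0 := by
      rw [not_iff_not]
      exact ⟨fun h => h ▸ hk0, fun h => k.injective (h.trans hk0.symm)⟩
    let k' := f.symm.permCongr (k.subtypePerm fun x => (hk' x).symm)
    refine ⟨k', ?_⟩
    suffices h : Equiv.Perm.extendDomainHom f k' = k by rw [h, hk]
    ext1 x
    by_cases hx : x = 0
    · rw [hx, Equiv.Perm.extendDomainHom_apply,
        Equiv.Perm.extendDomain_apply_not_subtype (p := (· ≠ 0)) _ _ (by simp), hk0]
    · rw [Equiv.Perm.extendDomainHom_apply, Equiv.Perm.extendDomain_apply_subtype (p := (· ≠ 0)) _ _ hx]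
      simp [k', Equiv.permCongr_apply]

section FrobeniusSchur

variable {G V : Type} [Group G] [Fintype G] [AddCommGroup V] [Module ℂ V] [FiniteDimensional ℂ V]
  (ρ : Representation ℂ G V) [ρ.IsIrreducible]

omit [Fintype G] in
lemma exists_smul_of_commute (T : V →ₗ[ℂ] V) (hT : ∀ g, T ∘ₗ ρ g = ρ g ∘ₗ T) :
    ∃ c : ℂ, T = c • LinearMap.id := by
  obtain ⟨c, hc⟩ := (Representation.IsIrreducible.algebraMap_intertwiningMap_bijective_of_isAlgClosed
    (ρ := ρ)).2 ⟨T, hT⟩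
  exact ⟨c, congrArg Representation.IntertwiningMap.toLinearMap hc.symm⟩

lemma finrank_smul_sum_conj (Y : V →ₗ[ℂ] V) :
    (Module.finrank ℂ V : ℂ) • ∑ g, ρ g * Y * ρ g⁻¹ =
      ((Fintype.card G : ℂ) * LinearMap.trace ℂ V Y) • LinearMap.id := by
  obtain ⟨c, hc⟩ := exists_smul_of_commute ρ (∑ g, ρ g * Y * ρ g⁻¹) fun h => by
    change (∑ g, ρ g * Y * ρ g⁻¹) * ρ h = ρ h * ∑ g, ρ g * Y * ρ g⁻¹
    rw [Finset.sum_mul, Finset.mul_sum]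
    refine Fintype.sum_equiv (Equiv.mulLeft h⁻¹) _ _ fun g => ?_
    simp only [Equiv.coe_mulLeft, mul_inv_rev, inv_inv, map_mul, mul_assoc]
    rw [← mul_assoc (ρ h) (ρ h⁻¹), ← map_mul ρ h, mul_inv_cancel, map_one, one_mul]
  have ht := congrArg (LinearMap.trace ℂ V) hc
  have hconj (g : G) : LinearMap.trace ℂ V (ρ g * Y * ρ g⁻¹) = LinearMap.trace ℂ V Y := by
    rw [LinearMap.trace_mul_comm, ← mul_assoc, ← map_mul, inv_mul_cancel, map_one, one_mul]
  simp only [map_sum, hconj, map_smul, LinearMap.trace_id, Finset.sum_const, Finset.card_univ,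
    nsmul_eq_mul, smul_eq_mul] at ht
  rw [hc, ht, smul_smul, mul_comm]

lemma sum_character_sq (h : HasInvariantSymmForm ρ) :
    ∑ g, ρ.character (g ^ 2) = Fintype.card G := by
  classical
  obtain ⟨β, hβ0, hβs, hβ⟩ := h
  have hβ' (g : G) (v w : V) : β (ρ g v) w = β v (ρ g⁻¹ w) := by
    rw [← hβ g v, ← Module.End.mul_apply, ← map_mul]; simp
  have hinj : Function.Injective β :=
    (Representation.IsIrreducible.injective_or_eq_zero
      (⟨β, fun g => by
        ext v w
        simp [hβ', Representation.dual_apply, Module.Dual.transpose_apply]⟩ :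
        Representation.IntertwiningMap ρ ρ.dual)).resolve_right
      fun h => hβ0 (congrArg Representation.IntertwiningMap.toLinearMap h)
  have hnd : LinearMap.BilinForm.Nondegenerate β := by
    refine ⟨fun v hv => hinj (by ext w; simpa using hv w), fun v hv => hinj ?_⟩
    ext w
    simpa [hβs v] using hv w
  let b := Module.finBasis ℂ V
  let b' := LinearMap.BilinForm.dualBasis β hnd b
  have hb (i j) : β (b' i) (b j) = if j = i then 1 else 0 :=
    LinearMap.BilinForm.apply_dualBasis_left hnd b i j
  have hcoord (i v) : b.repr v i = β (b' i) v :=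
    LinearMap.congr_fun (b.ext (f₁ := b.coord i) (f₂ := β (b' i))
      fun j => by simp [hb, Finsupp.single_apply]) v
  have hrepr (v : V) : v = ∑ i, β (b' i) v • b i := by
    simp only [← hcoord, b.sum_repr]
  have hrepr' (v : V) : v = ∑ i, β v (b i) • b' i := by
    conv_lhs => rw [← b'.sum_repr v]
    simp [b']
  have htr (X : V →ₗ[ℂ] V) : LinearMap.trace ℂ V X = ∑ i, β (b' i) (X (b i)) := by
    simp [LinearMap.trace_eq_matrix_trace ℂ b, Matrix.trace, LinearMap.toMatrix_apply, hcoord]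
  have hd : (Module.finrank ℂ V : ℂ) ≠ 0 := by
    rw [Nat.cast_ne_zero]
    intro h
    have := Module.finrank_zero_iff.1 h
    exact hβ0 (by ext v; simp [Subsingleton.elim v 0])
  have hchar (g : G) : ρ.character (g ^ 2) =
      ∑ i, ∑ j, β (b' i) (ρ g (b j)) * β (b i) (ρ g⁻¹ (b' j)) := by
    rw [Representation.character, htr]
    refine Finset.sum_congr rfl fun i _ => ?_
    rw [pow_two, map_mul, Module.End.mul_apply]
    conv_lhs => rw [hrepr (ρ g (b i))]
    simp only [map_sum, map_smul, smul_eq_mul]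
    refine Finset.sum_congr rfl fun j _ => ?_
    rw [mul_comm, hβs (b' j), hβ']
  apply mul_left_cancel₀ hd
  have key (i j) : (Module.finrank ℂ V : ℂ) * ∑ g, β (b' i) (ρ g (b j)) * β (b i) (ρ g⁻¹ (b' j)) =
      Fintype.card G * (β (b i) (b j) * β (b' i) (b' j)) := by
    have := congrArg (fun T => β (b' i) (T (b' j)))
      (finrank_smul_sum_conj ρ ((β (b i)).smulRight (b j)))
    rw [LinearMap.trace_smulRight] at this
    simp only [LinearMap.smul_apply, LinearMap.sum_apply, Module.End.mul_apply,
      LinearMap.smulRight_apply, map_smul, map_sum, smul_eq_mul, LinearMap.id_apply] at this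
    rw [← mul_assoc, ← this]
    simp only [mul_comm]
  simp only [hchar]
  rw [Finset.sum_comm, Finset.mul_sum]
  have hsum (i) : (Module.finrank ℂ V : ℂ) *
      ∑ g, ∑ j, β (b' i) (ρ g (b j)) * β (b i) (ρ g⁻¹ (b' j)) = Fintype.card G := by
    rw [Finset.sum_comm, Finset.mul_sum]
    simp only [key, ← Finset.mul_sum]
    have h1 : ∑ j, β (b i) (b j) * β (b' i) (b' j) = 1 := by
      have := congrArg (β (b' i)) (hrepr' (b i))
      rw [hb, if_pos rfl, map_sum] at this
      simpa using this.symm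
    rw [h1, mul_one]
  simp [hsum]

end FrobeniusSchur

lemma Representation.IsIrreducible.simple_of {G V : Type} [Group G] [Finite G] [AddCommGroup V]
    [Module ℂ V] [FiniteDimensional ℂ V] (ρ : Representation ℂ G V) [ρ.IsIrreducible] :
    Simple (FDRep.of ρ) := by
  have := Fintype.ofFinite G
  have : Invertible (Nat.card G : ℂ) := invertibleOfNonzero (NeZero.ne _)
  rw [FDRep.simple_iff_char_is_norm_one]
  have h := Representation.card_inv_mul_sum_char_mul_char_eq_finrank ρ ρ
  rw [Representation.IsIrreducible.finrank_intertwiningMap_self, Nat.cast_one,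
    inv_mul_eq_one₀ (NeZero.ne _)] at h
  exact h.symm

lemma eq_zero_of_forall_sum_mul_character_eq_zero {G : Type} [Group G] [Fintype G] (f : G → ℂ)
    (hf : ∀ g h, f (h * g * h⁻¹) = f g)
    (h0 : ∀ (V : Type) [AddCommGroup V] [Module ℂ V] [FiniteDimensional ℂ V]
      (ρ : Representation ℂ G V) [ρ.IsIrreducible], ∑ g, f g * ρ.character g = 0) :
    f = 0 := by
  classical
  have hsum (V : Type) [AddCommGroup V] [Module ℂ V] [FiniteDimensional ℂ V]
      (ρ : Representation ℂ G V) [ρ.IsIrreducible] : ∑ g, f g • ρ g = 0 := by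
    obtain ⟨c, hc⟩ := exists_smul_of_commute ρ (∑ g, f g • ρ g) fun h => by
      change (∑ g, f g • ρ g) * ρ h = ρ h * ∑ g, f g • ρ g
      rw [Finset.sum_mul, Finset.mul_sum]
      refine Fintype.sum_equiv (MulAut.conj h⁻¹).toEquiv _ _ fun g => ?_
      have := hf g h⁻¹
      simp_all [mul_assoc, ← map_mul]
    have ht := congrArg (LinearMap.trace ℂ V) hc
    simp only [map_sum, map_smul, LinearMap.trace_id, smul_eq_mul] at ht
    rw [show ∑ g, f g * LinearMap.trace ℂ V (ρ g) = 0 from h0 V ρ] at ht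
    rcases mul_eq_zero.1 ht.symm with h | h
    · rw [hc, h, zero_smul]
    · have := Module.finrank_zero_iff.1 (Nat.cast_eq_zero.1 h)
      exact Subsingleton.elim _ _
  let a : MonoidAlgebra ℂ G := ∑ g, MonoidAlgebra.single g (f g)
  have : FiniteDimensional ℂ (MonoidAlgebra ℂ G) := inferInstance
  have hsimple (M : Submodule (MonoidAlgebra ℂ G) (MonoidAlgebra ℂ G))
      [IsSimpleModule (MonoidAlgebra ℂ G) M] (x : M) : a • x = 0 := by
    let ρ : Representation ℂ G M := Representation.ofModule' M
    have hρ (g : G) (c : ℂ) (y : M) : MonoidAlgebra.single g c • y = c • ρ g y := by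
      rw [show MonoidAlgebra.single g c = c • MonoidAlgebra.single g (1 : ℂ) by simp, smul_assoc]
      simp [ρ, Representation.ofModule']
    have := IsSimpleModule.nontrivial (MonoidAlgebra ℂ G) M
    have hirr : ρ.IsIrreducible := by
      by_contra h
      obtain ⟨W, hW, hW', hWρ⟩ := exists_invariant_submodule_of_not_isIrreducible ρ h
      let N : Submodule (MonoidAlgebra ℂ G) M :=
        { W with
          smul_mem' := fun c y hy => by
            induction c using MonoidAlgebra.induction_linear with
            | zero => rw [zero_smul]; exact W.zero_mem
            | add c d hc hd => rw [add_smul]; exact W.add_mem hc hd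
            | single g c => rw [hρ]; exact W.smul_mem c (hWρ g hy) }
      have hN (y : M) : y ∈ N ↔ y ∈ W := Iff.rfl
      rcases eq_bot_or_eq_top N with h | h
      · exact hW (by ext y; simp [← hN, h])
      · exact hW' (by ext y; simp [← hN, h])
    have := LinearMap.congr_fun (hsum M ρ) x
    simpa [a, Finset.sum_smul, hρ] using this
  have ha (x : MonoidAlgebra ℂ G) : a • x = 0 := by
    have hx : x ∈ sSup {M : Submodule (MonoidAlgebra ℂ G) (MonoidAlgebra ℂ G) |
        IsSimpleModule (MonoidAlgebra ℂ G) M} := by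
      rw [IsSemisimpleModule.sSup_simples_eq_top]; trivial
    rw [sSup_eq_iSup'] at hx
    refine Submodule.iSup_induction _ (motive := fun x => a • x = 0) hx (fun M y hy => ?_)
      (smul_zero a) fun y z hy hz => by rw [smul_add, hy, hz, add_zero]
    have : IsSimpleModule (MonoidAlgebra ℂ G) M.1 := M.2
    exact congrArg Subtype.val (hsimple M.1 ⟨y, hy⟩)
  have ha0 : a = 0 := by simpa using ha 1
  funext g
  have := congrArg (fun x => x.coeff g) ha0
  simpa [a, MonoidAlgebra.coeff_sum, Finsupp.single_apply] using this

lemma IsIrrFamily.sum_mul_character {G : Type} [Group G] [Fintype G] {S : Finset (G → ℂ)}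
    (hS : IsIrrFamily G S) (V : FDRep ℂ G) [Simple V] :
    ∑ χ ∈ S, ∑ g, χ g * V.character g⁻¹ = Fintype.card G := by
  classical
  have : Invertible (Nat.card G : ℂ) := invertibleOfNonzero (NeZero.ne _)
  rw [Finset.sum_eq_single_of_mem _ (hS.2 V ‹_›)]
  · have h := (FDRep.simple_iff_char_is_norm_one V).1 ‹_›
    rw [h, Nat.card_eq_fintype_card]
  · intro χ hχ hne
    obtain ⟨W, hW, rfl⟩ := hS.1 χ hχ
    have h := FDRep.char_orthonormal W V
    rw [if_neg fun ⟨i⟩ => hne (FDRep.char_iso i), mul_eq_zero] at h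
    exact h.resolve_left (inv_ne_zero (NeZero.ne _))

lemma IsIrrFamily.sum_apply_eq_card_sqrt {G : Type} [Group G] [Fintype G] {S : Finset (G → ℂ)}
    (hS : IsIrrFamily G S) (hinv : ∀ g : G, IsConj g g⁻¹)
    (hG : ∀ (V : Type) [AddCommGroup V] [Module ℂ V] [FiniteDimensional ℂ V] [Nontrivial V]
      (ρ : Representation ℂ G V), HasInvariantSymmForm ρ) (g : G) :
    ∑ χ ∈ S, χ g = Nat.card {x : G // x ^ 2 = g} := by
  classical
  have hcard (g : G) : (Nat.card {x : G // x ^ 2 = g} : ℂ) = ∑ x : G, if x ^ 2 = g then 1 else 0 := by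
    simp [Fintype.card_subtype]
  suffices h : (fun g => (Nat.card {x : G // x ^ 2 = g} : ℂ) - ∑ χ ∈ S, χ g) = 0 from
    (sub_eq_zero.1 (congrFun h g)).symm
  refine eq_zero_of_forall_sum_mul_character_eq_zero _ (fun g h => ?_) fun V _ _ _ ρ _ => ?_
  · congr 1
    · exact congrArg _ (card_sqrt_congr (MulEquiv.refl G) (isConj_iff.2 ⟨h⁻¹, by simp [mul_assoc]⟩))
    · refine Finset.sum_congr rfl fun χ hχ => ?_
      obtain ⟨W, -, rfl⟩ := hS.1 χ hχ
      exact W.char_conj g h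
  · have hnt : Nontrivial V := by
      by_contra hV
      rw [not_nontrivial_iff_subsingleton] at hV
      exact bot_ne_top (α := Subrepresentation ρ)
        (Subrepresentation.toSubmodule_injective (Subsingleton.elim _ _))
    have hreal (g : G) : ρ.character g⁻¹ = ρ.character g := by
      obtain ⟨c, hc⟩ := isConj_iff.1 (hinv g)
      rw [← hc, ρ.char_conj]
    have := Representation.IsIrreducible.simple_of ρ
    have h1 : ∑ χ ∈ S, ∑ g, χ g * ρ.character g⁻¹ = Fintype.card G :=
      hS.sum_mul_character (FDRep.of ρ)
    simp only [hreal] at h1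
    rw [Finset.sum_comm] at h1
    simp only [sub_mul, Finset.sum_sub_distrib, Finset.sum_mul, h1, hcard]
    rw [Finset.sum_comm, sub_eq_zero, ← sum_character_sq ρ (hG V ρ)]
    simp

lemma sqrtCount_eq {m : ℕ} {ν : m.Partition} (hν : 1 ∉ ν.parts) {α : Type*} [Fintype α]
    [DecidableEq α] (hα : Fintype.card α = m) {w : Equiv.Perm α} (hw : w.cycleType = ν.parts) :
    sqrtCount ν = Nat.card {x : Equiv.Perm α // x ^ 2 = w} := by
  have h2 (a : ℕ) (ha : a ∈ ν.parts) : 2 ≤ a := by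
    have := ν.parts_pos ha
    have : a ≠ 1 := fun h => hν (h ▸ ha)
    omega
  have h : ∃ w : Equiv.Perm (Fin m), w.partition.parts = ν.parts := by
    obtain ⟨w, hw⟩ := (Equiv.Perm.exists_with_cycleType_iff (Fin m) (m := ν.parts)).2
      ⟨by simp [ν.parts_sum], h2⟩
    refine ⟨w, ?_⟩
    rw [Equiv.Perm.parts_partition, ← Equiv.Perm.sum_cycleType, hw, ν.parts_sum]
    simp
  rw [sqrtCount, dif_pos h]
  refine Equiv.Perm.card_sqrt_eq_of_cycleType_eq (by simp [hα]) ?_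
  rw [hw, ← Equiv.Perm.filter_parts_partition_eq_cycleType, h.choose_spec,
    Multiset.filter_eq_self.2 h2]

lemma card_sqrt_eq_numInvolutions_mul_sqrtCount {n k : ℕ} (hk : k ≤ n) {ν : (n - k).Partition}
    (hν : 1 ∉ ν.parts) {w : Equiv.Perm (Fin n)} (hw : w.cycleType = ν.parts) :
    Nat.card {x : Equiv.Perm (Fin n) // x ^ 2 = w} = numInvolutions k * sqrtCount ν := by
  have hc : Fintype.card {a // w a ≠ a} = n - k := by
    rw [← ν.parts_sum, ← hw, Equiv.Perm.sum_cycleType, Fintype.card_subtype]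
    rfl
  have hc' : Fintype.card {a // ¬ w a ≠ a} = k := by
    rw [Fintype.card_subtype_compl, hc, Fintype.card_fin, Nat.sub_sub_self hk]
  rw [Equiv.Perm.card_sqrt_eq_mul, numInvolutions]
  congr 1
  · exact Equiv.Perm.card_sqrt_eq_of_cycleType_eq (hc'.trans (Fintype.card_fin k).symm) (by simp)
  · refine (sqrtCount_eq hν hc ?_).symm
    rw [← hw, ← Equiv.Perm.cycleType_ofSubtype, Equiv.Perm.ofSubtype_subtypePerm _ fun a h => h]

lemma sum_conjClasses_card_sqrt (n : ℕ) :
    ∑ᶠ C : ConjClasses (Equiv.Perm (Fin n)),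
      Nat.card {x : Equiv.Perm (Fin n) // x ^ 2 = Quotient.out C} =
      ∑ k ∈ Finset.range (n + 1), numInvolutions k * gFun (n - k) := by
  classical
  have := Fintype.ofFinite (ConjClasses (Equiv.Perm (Fin n)))
  simp only [gFun, Finset.mul_sum]
  rw [finsum_eq_sum_of_fintype, Finset.sum_sigma']
  have hex (p : (k : ℕ) × (n - k).Partition) (hp : 1 ∉ p.2.parts) :
      ∃ w : Equiv.Perm (Fin n), w.cycleType = p.2.parts := by
    rw [Equiv.Perm.exists_with_cycleType_iff, p.2.parts_sum, Fintype.card_fin]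
    refine ⟨Nat.sub_le _ _, fun a ha => ?_⟩
    have := p.2.parts_pos ha
    have : a ≠ 1 := fun h => hp (h ▸ ha)
    omega
  choose! w hw using hex
  symm
  refine Finset.sum_bij (fun p _ => ConjClasses.mk (w p)) (fun _ _ => Finset.mem_univ _)
    (fun p hp q hq h => ?_) (fun C _ => ?_) fun p hp => ?_
  · simp only [Finset.mem_sigma, Finset.mem_range, Finset.mem_filter, Finset.mem_univ,
      true_and] at hp hq
    rw [ConjClasses.mk_eq_mk_iff_isConj, Equiv.Perm.isConj_iff_cycleType_eq, hw p hp.2,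
      hw q hq.2] at h
    obtain ⟨k, ν⟩ := p
    obtain ⟨l, μ⟩ := q
    dsimp only at h hp hq
    have h1 := ν.parts_sum
    rw [h, μ.parts_sum] at h1
    obtain rfl : k = l := by omega
    obtain rfl : ν = μ := Nat.Partition.ext h
    rfl
  · induction C using Quotient.inductionOn with
    | h σ =>
      have h1 := σ.sum_cycleType_le
      rw [Fintype.card_fin] at h1
      let p : (k : ℕ) × (n - k).Partition := ⟨n - σ.cycleType.sum, σ.cycleType,
        fun {a} ha => lt_of_lt_of_le two_pos (Equiv.Perm.two_le_of_mem_cycleType ha), by omega⟩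
      have hp : 1 ∉ p.2.parts := fun h => by
        have := Equiv.Perm.two_le_of_mem_cycleType (σ := σ) h
        omega
      refine ⟨p, by simp [p, hp], ConjClasses.mk_eq_mk_iff_isConj.2 ?_⟩
      rw [Equiv.Perm.isConj_iff_cycleType_eq, hw p hp]
  · simp only [Finset.mem_sigma, Finset.mem_range, Finset.mem_filter, Finset.mem_univ,
      true_and] at hp
    rw [← card_sqrt_eq_numInvolutions_mul_sqrtCount (by omega) hp.2 (hw p hp.2)]
    refine card_sqrt_congr (MulEquiv.refl _) ?_
    exact ConjClasses.mk_eq_mk_iff_isConj.1 (Quotient.out_eq (ConjClasses.mk (w p))).symm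

/-- For every positive `n`, the character table sum `s_n` of `S_n` satisfies the
convolution `s_n = ∑_{k=0}^n i_k g_{n-k}`. -/
theorem tableSum_symmetric_convolution (n : ℕ) (hn : 1 ≤ n)
    (S : Finset (Equiv.Perm (Fin n) → ℂ)) (hS : IsIrrFamily (Equiv.Perm (Fin n)) S) :
    tableSum (Equiv.Perm (Fin n)) S =
      ((∑ k ∈ Finset.range (n + 1), numInvolutions k * gFun (n - k) : ℕ) : ℂ) := by
  have := Fintype.ofFinite (ConjClasses (Equiv.Perm (Fin n)))
  have hinv (g : Equiv.Perm (Fin n)) : IsConj g g⁻¹ :=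
    Equiv.Perm.isConj_of_cycleType_eq g.cycleType_inv.symm
  rw [← sum_conjClasses_card_sqrt, tableSum]
  simp only [finsum_eq_sum_of_fintype]
  rw [Finset.sum_comm, Nat.cast_sum]
  exact Finset.sum_congr rfl fun C _ =>
    hS.sum_apply_eq_card_sqrt hinv (Equiv.Perm.hasInvariantSymmForm n) _
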